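/- arXiv:2507.05842 — 4 statements merged into one kernel-verified Lean document; each statement's English description precedes it below -/
import Mathlib

section
/- Let r, ν, a be positive integers with a ≤ ν + 1. Let S_1, …, S_a be r-uniform sunflowers, each with (ν+1)·r petals, whose cores are pairwise disjoint. Let M be a matching consisting of ν − a + 1 pairwise disjoint r-sets whose vertex set is disjoint from the cores of S_1, …, S_a. Then the hypergraph S_1 ∪ … ∪ S_a ∪ M contains a matching of size ν + 1. -/
/-!
Statement 4: Let `r, ν, a` be positive integers with `a ≤ ν + 1`. Let `S_1, …, S_a` be
`r`-uniform sunflowers, each with `(ν+1)·r` petals, whose cores are pairwise disjoint.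
Let `M` be a matching of `ν − a + 1` pairwise disjoint `r`-sets whose vertex set is
disjoint from the cores of `S_1, …, S_a`. Then `S_1 ∪ … ∪ S_a ∪ M` contains a matching
of size `ν + 1`.
-/

/-- `S` is an `r`-uniform sunflower with core `C` and `t` petals: `t` edges, each an
`r`-set containing `C`, any two of which intersect exactly in `C`. -/
def IsSunflower (r t : ℕ) (S : Finset (Finset ℕ)) (C : Finset ℕ) : Prop :=
  S.card = t ∧ (∀ e ∈ S, e.card = r ∧ C ⊆ e) ∧
    (S : Set (Finset ℕ)).Pairwise fun e f => e ∩ f = C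

/-- A sunflower with more petals than `F` has elements has an edge avoiding `F`, provided that
its core avoids `F`. -/
theorem IsSunflower.exists_disjoint {r t : ℕ} {S : Finset (Finset ℕ)} {C F : Finset ℕ}
    (hS : IsSunflower r t S C) (hC : Disjoint C F) (hF : F.card < t) :
    ∃ e ∈ S, Disjoint e F := by
  obtain ⟨hcard, -, hinter⟩ := hS
  by_contra! h
  have hx : ∀ e ∈ S, ∃ x, x ∈ e ∧ x ∈ F := fun e he => Finset.not_disjoint_iff.1 (h e he)
  choose! x hxe hxF using hx
  obtain ⟨e, he, f, hf, hef, hxef⟩ :=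
    Finset.exists_ne_map_eq_of_card_lt_of_maps_to (hF.trans_eq hcard.symm) hxF
  have hmem : x e ∈ e ∩ f := Finset.mem_inter.2 ⟨hxe e he, hxef ▸ hxe f hf⟩
  rw [hinter he hf hef] at hmem
  exact Finset.disjoint_left.1 hC hmem (hxF e he)

theorem IsSunflower.card_core_le {r t : ℕ} {S : Finset (Finset ℕ)} {C : Finset ℕ}
    (hS : IsSunflower r t S C) (ht : 0 < t) : C.card ≤ r := by
  obtain ⟨e, he⟩ := Finset.card_pos.1 (ht.trans_eq hS.1.symm)
  exact (Finset.card_le_card (hS.2.1 e he).2).trans_eq (hS.2.1 e he).1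

/-- If sunflowers with pairwise disjoint cores avoiding `V` have sufficiently many petals, then
the cores indexed by `T` can be replaced by edges, keeping everything disjoint. -/
theorem exists_disjoint_edges_of_sunflowers {ι : Type*} [Fintype ι] [DecidableEq ι] {r t : ℕ}
    {S : ι → Finset (Finset ℕ)} {C : ι → Finset ℕ} {V : Finset ℕ}
    (hS : ∀ i, IsSunflower r t (S i) (C i))
    (hC : Pairwise fun i j => Disjoint (C i) (C j)) (hV : ∀ i, Disjoint (C i) V)
    (ht : (Fintype.card ι - 1) * r + V.card < t) (T : Finset ι) :
    ∃ f : ι → Finset ℕ, (∀ i ∈ T, f i ∈ S i) ∧ (∀ i ∉ T, f i = C i) ∧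
      (∀ i, (f i).card ≤ r) ∧ (Pairwise fun i j => Disjoint (f i) (f j)) ∧
      ∀ i, Disjoint (f i) V := by
  induction T using Finset.induction_on with
  | empty =>
    exact ⟨C, by simp, by simp, fun i => (hS i).card_core_le (Nat.zero_lt_of_lt ht), hC, hV⟩
  | insert i T hi ih =>
    obtain ⟨f, hfS, hfC, hfr, hf, hfV⟩ := ih
    have hcard : (((Finset.univ.erase i).biUnion f) ∪ V).card < t := by
      refine (Finset.card_union_le _ _).trans_lt (lt_of_le_of_lt ?_ ht)
      gcongr
      refine (Finset.card_biUnion_le_card_mul _ _ r fun j _ => hfr j).trans_eq ?_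
      rw [Finset.card_erase_of_mem (Finset.mem_univ i), Finset.card_univ]
    have hcore : Disjoint (C i) (((Finset.univ.erase i).biUnion f) ∪ V) := by
      rw [Finset.disjoint_union_right, Finset.disjoint_biUnion_right]
      exact ⟨fun j hj => hfC i hi ▸ hf (Finset.ne_of_mem_erase hj).symm, hV i⟩
    obtain ⟨e, he, hdisj⟩ := (hS i).exists_disjoint hcore hcard
    rw [Finset.disjoint_union_right, Finset.disjoint_biUnion_right] at hdisj
    obtain ⟨hef, heV⟩ := hdisj
    have hef' : ∀ j, j ≠ i → Disjoint e (f j) := fun j hj => hef j (by simp [hj])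
    refine ⟨Function.update f i e, fun j hj => ?_, fun j hj => ?_, fun j => ?_,
      fun j k hjk => ?_, fun j => ?_⟩
    · obtain rfl | hji := eq_or_ne j i
      · simpa using he
      · simpa [hji] using hfS j (Finset.mem_of_mem_insert_of_ne hj hji)
    · rw [Finset.mem_insert, not_or] at hj
      simpa [hj.1] using hfC j hj.2
    · obtain rfl | hji := eq_or_ne j i
      · simpa using ((hS j).2.1 e he).1.le
      · simpa [hji] using hfr j
    · obtain rfl | hji := eq_or_ne j i
      · simpa [hjk.symm] using hef' k hjk.symm
      · obtain rfl | hki := eq_or_ne k i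
        · simpa [hji] using (hef' j hji).symm
        · simpa [hji, hki] using hf hjk
    · obtain rfl | hji := eq_or_ne j i
      · simpa using heV
      · simpa [hji] using hfV j

theorem stmt4 (r ν a : ℕ) (hr : 1 ≤ r) (hν : 1 ≤ ν) (ha : 1 ≤ a) (haν : a ≤ ν + 1)
    (S : Fin a → Finset (Finset ℕ)) (C : Fin a → Finset ℕ)
    (hS : ∀ i, IsSunflower r ((ν + 1) * r) (S i) (C i))
    (hCdisj : ∀ i j, i ≠ j → Disjoint (C i) (C j))
    (M : Finset (Finset ℕ))
    (hMcard : M.card = ν + 1 - a)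
    (hMr : ∀ e ∈ M, e.card = r)
    (hMdisj : (M : Set (Finset ℕ)).Pairwise fun e f => Disjoint e f)
    (hMC : ∀ e ∈ M, ∀ i, Disjoint e (C i)) :
    ∃ N : Finset (Finset ℕ), N ⊆ Finset.univ.biUnion S ∪ M ∧ N.card = ν + 1 ∧
      (N : Set (Finset ℕ)).Pairwise fun e f => Disjoint e f := by
  have hVcard : (M.biUnion id).card ≤ (ν + 1 - a) * r :=
    hMcard ▸ Finset.card_biUnion_le_card_mul _ _ r fun e he => (hMr e he).le
  have hlt : (Fintype.card (Fin a) - 1) * r + (M.biUnion id).card < (ν + 1) * r := by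
    rw [Fintype.card_fin]
    calc (a - 1) * r + (M.biUnion id).card ≤ (a - 1) * r + (ν + 1 - a) * r := by gcongr
      _ = ν * r := by rw [← add_mul]; congr 1; omega
      _ < (ν + 1) * r := by gcongr; omega
  obtain ⟨f, hfS, -, -, hf, hfV⟩ := exists_disjoint_edges_of_sunflowers hS
    (fun i j => hCdisj i j)
    (fun i => (Finset.disjoint_biUnion_right _ _ _).2 fun e he => (hMC e he i).symm)
    hlt Finset.univ
  have hfM : ∀ i, ∀ e ∈ M, Disjoint (f i) e := fun i =>
    (Finset.disjoint_biUnion_right _ _ _).1 (hfV i)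
  have hne : ∀ i, f i ≠ ∅ := by
    intro i h
    have hcard := ((hS i).2.1 _ (hfS i (Finset.mem_univ i))).1
    rw [h, Finset.card_empty] at hcard
    omega
  have hinj : Function.Injective f := by
    intro i j hij
    by_contra h
    have hd : Disjoint (f i) (f j) := hf h
    rw [← hij] at hd
    exact hne i (Finset.disjoint_self_iff_empty _ |>.1 hd)
  have hdisj : Disjoint (Finset.univ.image f) M := by
    rw [Finset.disjoint_left]
    intro e he heM
    obtain ⟨i, -, rfl⟩ := Finset.mem_image.1 he
    exact hne i (Finset.disjoint_self_iff_empty _ |>.1 (hfM i _ heM))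
  refine ⟨Finset.univ.image f ∪ M, Finset.union_subset_union_left ?_, ?_, ?_⟩
  · intro e he
    obtain ⟨i, hi, rfl⟩ := Finset.mem_image.1 he
    exact Finset.mem_biUnion.2 ⟨i, hi, hfS i hi⟩
  · rw [Finset.card_union_of_disjoint hdisj, Finset.card_image_of_injective _ hinj,
      Finset.card_univ, Fintype.card_fin, hMcard]
    omega
  · intro e he e' he' hee'
    simp only [Finset.coe_union, Finset.coe_image, Finset.coe_univ, Set.image_univ,
      Set.mem_union, Set.mem_range, Finset.mem_coe] at he he'
    obtain ⟨i, rfl⟩ | he := he <;> obtain ⟨j, rfl⟩ | he' := he'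
    · exact hf fun h => hee' (congrArg f h)
    · exact hfM i _ he'
    · exact (hfM j _ he).symm
    · exact hMdisj he he' hee'
end

section
/- Let r ≥ 2 and k > 2^(9r). Suppose that the r-uniform, r-partite hypergraph H is c-Ryser-stable relative to r-uniform, r-partite hypergraphs H_1, …, H_ℓ. Let m > 0 and let (V, d_1, …, d_r) be a family of metrics on a common finite vertex set containing an (m, km)-dual of H. Then at least one of the following holds: (1) V can be covered by c balls of radius km, each a ball in one of the metrics d_1, …, d_r; (2) there exists m' with m ≤ m' ≤ km such that (V, d_1, …, d_r) contains an (m', k^(1/(4r))·m')-dual of one of H_1, …, H_ℓ. -/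
/-!
Statement 9 (main technical lemma): let `r ≥ 2` and `k > 2^(9r)`. Suppose the
`r`-uniform, `r`-partite hypergraph `H` is `c`-Ryser-stable relative to `H_1, …, H_ℓ`.
Let `m > 0` and let `(V, d_1, …, d_r)` be a family of metrics containing an
`(m, km)`-dual of `H`. Then either `V` can be covered by `c` balls of radius `km` in
the metrics `d_1, …, d_r`, or there exists `m ≤ m' ≤ km` such that `(V, d_1, …, d_r)`
contains an `(m', k^(1/(4r))·m')`-dual of one of `H_1, …, H_ℓ`.

`r`-uniform, `r`-partite hypergraphs are modelled (up to isomorphism) as finite sets of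
edges, each edge being a function `Fin r → ℕ` picking one vertex in each part; the
vertex in part `i` of the edge `e` is the pair `(i, e i)`.
-/

abbrev PHyp (r : ℕ) := Finset (Fin r → ℕ)

/-- `C` is a vertex cover of `H`. -/
def IsCover {r : ℕ} (H : PHyp r) (C : Finset (Fin r × ℕ)) : Prop :=
  ∀ e ∈ H, ∃ i : Fin r, (i, e i) ∈ C

/-- `H'` contains an isomorphic copy of `H`. -/
def ContainsCopy {r : ℕ} (H' H : PHyp r) : Prop :=
  ∃ θ : Fin r → ℕ → ℕ,
    (∀ i, Set.InjOn (θ i) {v | ∃ e ∈ H, e i = v}) ∧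
    ∀ e ∈ H, (fun i => θ i (e i)) ∈ H'

/-- `H` is `c`-Ryser-stable relative to the list `Hs`. -/
def RyserStable {r : ℕ} (c : ℕ) (H : PHyp r) (Hs : List (PHyp r)) : Prop :=
  ∃ C : Finset (Fin r × ℕ), IsCover H C ∧ C.card ≤ c ∧
    ∀ H' : PHyp r, H ⊆ H' → (IsCover H' C ∨ ∃ K ∈ Hs, ContainsCopy H' K)

/-- `d` is a metric on `V`. -/
structure IsMetricFun {V : Type} (d : V → V → ℝ) : Prop where
  eq_zero_iff : ∀ x y, d x y = 0 ↔ x = y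
  symm : ∀ x y, d x y = d y x
  triangle : ∀ x y z, d x y ≤ d x z + d z y

/-- `φ` is an `(a,b)`-duality from `H` to `(V, d_1, …, d_r)`. -/
def IsDuality {r : ℕ} {V : Type} (d : Fin r → V → V → ℝ) (H : PHyp r)
    (φ : (Fin r → ℕ) → V) (a b : ℝ) : Prop :=
  Set.InjOn φ (H : Set (Fin r → ℕ)) ∧
    ∀ e ∈ H, ∀ f ∈ H, e ≠ f → ∀ i : Fin r,
      (e i = f i → d i (φ e) (φ f) ≤ a) ∧ (e i ≠ f i → b ≤ d i (φ e) (φ f))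

/-- `(V, d_1, …, d_r)` contains an `(a,b)`-dual of `H`. -/
def ContainsDual {r : ℕ} {V : Type} (d : Fin r → V → V → ℝ) (H : PHyp r)
    (a b : ℝ) : Prop :=
  ∃ φ, IsDuality d H φ a b

/-- Duals pass to isomorphic copies of subhypergraphs. -/
theorem ContainsDual.of_containsCopy {r : ℕ} {V : Type} {d : Fin r → V → V → ℝ}
    {H K : PHyp r} {a b : ℝ} (h : ContainsDual d H a b) (hK : ContainsCopy H K) :
    ContainsDual d K a b := by
  obtain ⟨φ, hinj, hφ⟩ := h
  obtain ⟨θ, hθ, hmem⟩ := hK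
  have key : ∀ e ∈ K, ∀ f ∈ K, ∀ i, θ i (e i) = θ i (f i) → e i = f i :=
    fun e he f hf i h => hθ i ⟨e, he, rfl⟩ ⟨f, hf, rfl⟩ h
  have key' : ∀ e ∈ K, ∀ f ∈ K, (fun i => θ i (e i)) = (fun i => θ i (f i)) → e = f :=
    fun e he f hf h => funext fun i => key e he f hf i (congrFun h i)
  refine ⟨fun e => φ fun i => θ i (e i), ?_, ?_⟩
  · intro e he f hf hef
    exact key' e he f hf (hinj (hmem e he) (hmem f hf) hef)
  · intro e he f hf hne i
    have h := hφ _ (hmem e he) _ (hmem f hf) (fun h => hne (key' e he f hf h)) i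
    exact ⟨fun hi => h.1 (congrArg (θ i) hi), fun hi => h.2 fun h' => hi (key e he f hf i h')⟩

/-- Extending a duality by one new edge, represented by the point `x`. -/
theorem IsDuality.containsDual_insert {r : ℕ} {V : Type} {d : Fin r → V → V → ℝ}
    (hd : ∀ i, IsMetricFun (d i)) {H : PHyp r} {φ : (Fin r → ℕ) → V} {a b a' b' : ℝ}
    (hφ : IsDuality d H φ a b) (ha : a ≤ a') (hb : b' ≤ b) (hb' : 0 < b')
    {w : Fin r → ℕ} (hw : w ∉ H) {x : V}
    (hx : ∀ e ∈ H, ∀ i, (w i = e i → d i x (φ e) ≤ a') ∧ (w i ≠ e i → b' ≤ d i x (φ e))) :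
    ContainsDual d (insert w H) a' b' := by
  have hne : ∀ e ∈ H, e ≠ w := fun e he h => hw (h ▸ he)
  have hxe : ∀ e ∈ H, x ≠ φ e := by
    intro e he h
    obtain ⟨i, hi⟩ := Function.ne_iff.1 (hne e he)
    have h1 := (hx e he i).2 (Ne.symm hi)
    rw [((hd i).eq_zero_iff x (φ e)).2 h] at h1
    linarith
  refine ⟨Function.update φ w x, ?_, ?_⟩
  · intro e he f hf hef
    rcases Finset.mem_insert.1 (Finset.mem_coe.1 he) with hew | he <;>
      rcases Finset.mem_insert.1 (Finset.mem_coe.1 hf) with hfw | hf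
    · exact hew.trans hfw.symm
    · rw [hew, Function.update_self, Function.update_of_ne (hne f hf)] at hef
      exact absurd hef (hxe f hf)
    · rw [hfw, Function.update_self, Function.update_of_ne (hne e he)] at hef
      exact absurd hef.symm (hxe e he)
    · rw [Function.update_of_ne (hne f hf), Function.update_of_ne (hne e he)] at hef
      exact hφ.1 he hf hef
  · intro e he f hf hef i
    rcases Finset.mem_insert.1 he with hew | he <;> rcases Finset.mem_insert.1 hf with hfw | hf
    · exact absurd (hew.trans hfw.symm) hef
    · rw [hew, Function.update_self, Function.update_of_ne (hne f hf)]
      exact hx f hf i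
    · rw [hfw, Function.update_self, Function.update_of_ne (hne e he), (hd i).symm]
      exact ⟨fun h => (hx e he i).1 h.symm, fun h => (hx e he i).2 (Ne.symm h)⟩
    · rw [Function.update_of_ne (hne f hf), Function.update_of_ne (hne e he)]
      have h := hφ.2 e he f hf hef i
      exact ⟨fun hi => (h.1 hi).trans ha, fun hi => hb.trans (h.2 hi)⟩

/-- A sequence of subsets of `Fin r` fails to gain an element at one of the first `r + 1` steps. -/
theorem exists_le_forall_succ_imp {r : ℕ} (P : Fin r → ℕ → Prop)
    (hmono : ∀ i j, P i j → P i (j + 1)) :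
    ∃ j ≤ r, ∀ i, P i (j + 1) → P i j := by
  classical
  by_contra! hcon
  have hcard : ∀ j ≤ r + 1, j ≤ (Finset.univ.filter fun i => P i j).card := by
    intro j
    induction j with
    | zero => intro _; exact Nat.zero_le _
    | succ j ih =>
      intro hj
      obtain ⟨i, hi, hi'⟩ := hcon j (by omega)
      refine (Nat.succ_le_succ (ih (by omega))).trans (Finset.card_lt_card ?_)
      refine Finset.ssubset_iff_subset_ne.2 ⟨fun i hi => ?_, fun h => hi' ?_⟩
      · simp only [Finset.mem_filter, Finset.mem_univ, true_and] at hi ⊢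
        exact hmono i j hi
      · have : i ∈ Finset.univ.filter fun i => P i (j + 1) := by simpa using hi
        rw [← h] at this
        simpa using this
  have h := (hcard (r + 1) le_rfl).trans (Finset.card_le_univ _)
  simp at h

/-- The scales `s₀ = 0`, `sⱼ₊₁ = L * (sⱼ + m)` separating near points from far points. -/
noncomputable def dualScale (L m : ℝ) : ℕ → ℝ
  | 0 => 0
  | j + 1 => L * (dualScale L m j + m)

theorem dualScale_nonneg {L m : ℝ} (hL : 0 ≤ L) (hm : 0 ≤ m) (j : ℕ) : 0 ≤ dualScale L m j := by
  induction j with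
  | zero => exact le_rfl
  | succ j ih => exact mul_nonneg hL (add_nonneg ih hm)

theorem dualScale_le_succ {L m : ℝ} (hL : 1 ≤ L) (hm : 0 ≤ m) (j : ℕ) :
    dualScale L m j ≤ dualScale L m (j + 1) := by
  have h := dualScale_nonneg (zero_le_one.trans hL) hm j
  change _ ≤ L * (dualScale L m j + m)
  nlinarith

theorem dualScale_add_le {L m : ℝ} (hL : 2 ≤ L) (hm : 0 ≤ m) (j : ℕ) :
    dualScale L m j + m ≤ L ^ (2 * j) * m := by
  induction j with
  | zero => simp [dualScale]
  | succ j ih =>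
    have h1 : (1 : ℝ) ≤ L ^ (2 * j) := one_le_pow₀ (by linarith)
    have h2 : L * (dualScale L m j + m) ≤ L * (L ^ (2 * j) * m) :=
      mul_le_mul_of_nonneg_left ih (by linarith)
    have h3 : m ≤ L ^ (2 * j) * m := le_mul_of_one_le_left hm h1
    have h4 : L ^ (2 * (j + 1)) * m = L * L * (L ^ (2 * j) * m) := by ring
    change L * (dualScale L m j + m) + m ≤ _
    have h5 : 0 ≤ L ^ (2 * j) * m * ((L - 2) * (L + 1) + 1) :=
      mul_nonneg (hm.trans h3) (by nlinarith)
    rw [h4]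
    nlinarith

theorem dualScale_add_succ_le {r j : ℕ} (hr : 2 ≤ r) (hj : j ≤ r) {L m : ℝ} (hL : 2 ≤ L)
    (hm : 0 ≤ m) : dualScale L m j + dualScale L m (j + 1) ≤ L ^ (4 * r) * m := by
  have h1 := dualScale_add_le hL hm (j + 1)
  have h2 := dualScale_le_succ (by linarith) hm j (L := L)
  have h3 : L ^ (2 * (j + 1) + 1) * m ≤ L ^ (4 * r) * m :=
    mul_le_mul_of_nonneg_right (pow_le_pow_right₀ (by linarith) (by omega)) hm
  have h4 : 0 ≤ L ^ (2 * (j + 1)) * m := by positivity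
  have h5 : L ^ (2 * (j + 1) + 1) * m = L * (L ^ (2 * (j + 1)) * m) := by ring
  nlinarith

/-- A point outside the balls given by a cover `C` of `H` extends `H` by an edge that `C` misses,
and the dual of `H` to a dual of the larger hypergraph. -/
theorem exists_insert_containsDual {r : ℕ} (hr : 2 ≤ r) {L m : ℝ} (hL : 2 ≤ L) (hm : 0 < m)
    {H : PHyp r} {C : Finset (Fin r × ℕ)} (hC : IsCover H C) {V : Type}
    {d : Fin r → V → V → ℝ} (hd : ∀ i, IsMetricFun (d i)) {φ : (Fin r → ℕ) → V}
    (hφ : IsDuality d H φ m (L ^ (4 * r) * m)) {x : V}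
    (hx : ∀ p ∈ C, (∃ e ∈ H, e p.1 = p.2) →
      ∃ e ∈ H, e p.1 = p.2 ∧ L ^ (4 * r) * m < d p.1 (φ e) x) :
    ∃ w m', ¬ IsCover (insert w H) C ∧ m ≤ m' ∧ m' ≤ L ^ (4 * r) * m ∧
      ContainsDual d (insert w H) m' (L * m') := by
  classical
  obtain ⟨j, hj, hgap⟩ := exists_le_forall_succ_imp
    (fun (i : Fin r) j => ∃ e ∈ H, d i x (φ e) ≤ dualScale L m j)
    (fun i j ⟨e, he, h⟩ => ⟨e, he, h.trans (dualScale_le_succ (by linarith) hm.le j)⟩)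
  have hsum := dualScale_add_succ_le hr hj hL hm.le
  have hs0 := dualScale_nonneg (by linarith : 0 ≤ L) hm.le j
  have hsucc : dualScale L m (j + 1) = L * (dualScale L m j + m) := rfl
  set s := dualScale L m j
  rw [hsucc] at hsum
  have hsm : s + m ≤ L ^ (4 * r) * m := by nlinarith
  have hch : ∀ i, ∃ v, (∃ e ∈ H, v = e i ∧ d i x (φ e) ≤ s) ∨
      ((∀ e ∈ H, v ≠ e i) ∧ (i, v) ∉ C ∧ ∀ e ∈ H, L * (s + m) ≤ d i x (φ e)) := by
    intro i
    by_cases h : ∃ e ∈ H, d i x (φ e) ≤ s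
    · obtain ⟨e, he, h⟩ := h
      exact ⟨e i, .inl ⟨e, he, rfl, h⟩⟩
    · obtain ⟨v, hv⟩ := Infinite.exists_notMem_finset (H.image (fun e => e i) ∪ C.image Prod.snd)
      rw [Finset.mem_union, not_or] at hv
      refine ⟨v, .inr ⟨fun e he h' => hv.1 ?_, fun h' => hv.2 ?_, fun e he => ?_⟩⟩
      · exact Finset.mem_image.2 ⟨e, he, h'.symm⟩
      · exact Finset.mem_image.2 ⟨_, h', rfl⟩
      · by_contra! hlt
        exact h (hgap i ⟨e, he, hlt.le⟩)
  choose w hw using hch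
  have hsame : ∀ e ∈ H, ∀ f ∈ H, ∀ i, e i = f i → d i (φ e) (φ f) ≤ m := by
    intro e he f hf i hi
    by_cases hef : e = f
    · rw [((hd i).eq_zero_iff _ _).2 (congrArg φ hef)]
      exact hm.le
    · exact (hφ.2 e he f hf hef i).1 hi
  have hdist : ∀ e ∈ H, ∀ i, (w i = e i → d i x (φ e) ≤ s + m) ∧
      (w i ≠ e i → L * (s + m) ≤ d i x (φ e)) := by
    intro e he i
    rcases hw i with ⟨f, hf, hwf, hfs⟩ | ⟨hne, -, hfar⟩
    · refine ⟨fun h => ?_, fun h => ?_⟩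
      · have h1 := (hd i).triangle x (φ e) (φ f)
        have h2 := hsame f hf e he i (hwf.symm.trans h)
        linarith
      · have hfe : f i ≠ e i := hwf ▸ h
        have h1 := (hφ.2 f hf e he (fun h' => hfe (congrFun h' i)) i).2 hfe
        have h2 := (hd i).triangle (φ f) (φ e) x
        rw [(hd i).symm (φ f) x] at h2
        linarith
    · exact ⟨fun h => absurd h (hne e he), fun _ => hfar e he⟩
  have hmiss : ∀ i, (i, w i) ∉ C := by
    intro i hi
    rcases hw i with ⟨f, hf, hwf, -⟩ | ⟨-, hnot, -⟩
    · obtain ⟨e, he, hew, hlt⟩ := hx _ hi ⟨f, hf, hwf.symm⟩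
      have h := (hdist e he i).1 hew.symm
      rw [(hd i).symm] at h
      exact absurd (hlt.trans_le h) (not_lt.2 hsm)
    · exact hnot hi
  have hwH : w ∉ H := fun h => (hC w h).elim hmiss
  refine ⟨w, s + m, fun h => (h w (Finset.mem_insert_self w H)).elim hmiss, by linarith, hsm, ?_⟩
  exact hφ.containsDual_insert hd (by linarith) (by linarith) (by positivity) hwH hdist

theorem stmt9 (r c : ℕ) (hr : 2 ≤ r) (k m : ℝ) (hk : (2 : ℝ) ^ (9 * r) < k) (hm : 0 < m)
    (H : PHyp r) (Hs : List (PHyp r)) (hstable : RyserStable c H Hs)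
    (V : Type) [Fintype V] (d : Fin r → V → V → ℝ) (hd : ∀ i, IsMetricFun (d i))
    (hdual : ContainsDual d H m (k * m)) :
    (∃ n ≤ c, ∃ (col : Fin n → Fin r) (ctr : Fin n → V),
        ∀ x : V, ∃ j, d (col j) (ctr j) x ≤ k * m) ∨
    (∃ m', m ≤ m' ∧ m' ≤ k * m ∧
        ∃ K ∈ Hs, ContainsDual d K m' (k ^ ((1 : ℝ) / (4 * (r : ℝ))) * m')) := by
  classical
  obtain ⟨C, hC, hcard, hst⟩ := hstable
  obtain ⟨φ, hφ⟩ := hdual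
  have h1k : (1 : ℝ) < k := lt_of_le_of_lt (one_le_pow₀ (by norm_num)) hk
  have hLk : (k ^ ((1 : ℝ) / (4 * (r : ℝ)))) ^ (4 * r) = k := by
    have hr0 : (r : ℝ) ≠ 0 := by positivity
    rw [← Real.rpow_natCast, ← Real.rpow_mul (by linarith)]
    push_cast
    rw [one_div_mul_cancel (by positivity), Real.rpow_one]
  set L := k ^ ((1 : ℝ) / (4 * (r : ℝ)))
  have hL0 : 0 ≤ L := Real.rpow_nonneg (by linarith) _
  have hL : 2 ≤ L := by
    by_contra! hlt
    have h1 : L ^ (4 * r) ≤ 2 ^ (4 * r) := pow_le_pow_left₀ hL0 hlt.le _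
    have h2 : (2 : ℝ) ^ (4 * r) ≤ 2 ^ (9 * r) := pow_le_pow_right₀ (by norm_num) (by omega)
    linarith
  rcases isEmpty_or_nonempty V with hV | ⟨⟨x₀⟩⟩
  · exact .inl ⟨0, Nat.zero_le c, Fin.elim0, Fin.elim0, fun x => hV.elim x⟩
  let ctr : Fin r × ℕ → V := fun p => if h : ∃ e ∈ H, e p.1 = p.2 then φ h.choose else x₀
  by_cases hcov : ∀ x, ∃ p ∈ C, d p.1 (ctr p) x ≤ k * m
  · refine .inl ⟨C.card, hcard, fun j => (C.equivFin.symm j).1.1,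
      fun j => ctr (C.equivFin.symm j).1, fun x => ?_⟩
    obtain ⟨p, hp, hpx⟩ := hcov x
    exact ⟨C.equivFin ⟨p, hp⟩, by simpa using hpx⟩
  · push Not at hcov
    obtain ⟨x, hx⟩ := hcov
    rw [← hLk] at hφ hx
    obtain ⟨w, m', hw, hm1, hm2, hdual⟩ := exists_insert_containsDual hr hL hm hC hd hφ
      (x := x) (fun p hp h => ⟨h.choose, h.choose_spec.1, h.choose_spec.2, by
        have := hx p hp
        simpa only [ctr, dif_pos h] using this⟩)
    rw [hLk] at hm2
    obtain ⟨K, hK, hcopy⟩ := (hst _ (Finset.subset_insert w H)).resolve_left hw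
    exact .inr ⟨m', hm1, hm2, K, hK, hdual.of_containsCopy hcopy⟩
end

section
/- Let r ≥ 1 be an integer, let k > 2^(9r) and m > 0 be real numbers, and let m_1 ≤ m_2 ≤ … ≤ m_r be nonnegative real numbers; set m_0 = m and m_{r+1} = k·m. Then there exists t' ∈ {0, 1, …, r} such that m_{t'+1} > k^(1/(3r))·m, m_{t'+1} > k^(1/(3r))·m_{t'}, and m_{t'} ≤ √k·m. -/
/-!
Statement 13: let `r ≥ 1` be an integer, `k > 2^(9r)` and `m > 0` real numbers, and
`m_1 ≤ m_2 ≤ … ≤ m_r` nonnegative reals, with `m_0 = m` and `m_{r+1} = k·m`. Then there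
is `t' ∈ {0, 1, …, r}` with `m_{t'+1} > k^(1/(3r))·m`, `m_{t'+1} > k^(1/(3r))·m_{t'}`,
and `m_{t'} ≤ √k·m`.
-/

theorem stmt13 (r : ℕ) (hr : 1 ≤ r) (k m : ℝ) (hk : (2 : ℝ) ^ (9 * r) < k) (hm : 0 < m)
    (ms : ℕ → ℝ)
    (h0 : ms 0 = m) (hlast : ms (r + 1) = k * m)
    (hnonneg : ∀ i, 1 ≤ i → i ≤ r → 0 ≤ ms i)
    (hmono : ∀ i, 1 ≤ i → i + 1 ≤ r → ms i ≤ ms (i + 1)) :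
    ∃ t' ≤ r, k ^ ((1 : ℝ) / (3 * (r : ℝ))) * m < ms (t' + 1) ∧
      k ^ ((1 : ℝ) / (3 * (r : ℝ))) * ms t' < ms (t' + 1) ∧
      ms t' ≤ Real.sqrt k * m := by
  have hk1 : 1 < k := lt_of_le_of_lt (one_le_pow₀ one_le_two) hk
  have hr' : (0 : ℝ) < r := by exact_mod_cast hr
  set c : ℝ := k ^ ((1 : ℝ) / (3 * (r : ℝ))) with hc
  have hc1 : 1 < c := Real.one_lt_rpow hk1 (by positivity)
  have hc0 : 0 < c := one_pos.trans hc1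
  have hck : c ^ (3 * r) = k := by
    rw [hc, ← Real.rpow_natCast, ← Real.rpow_mul (by linarith)]
    push_cast
    rw [one_div_mul_cancel (by positivity), Real.rpow_one]
  have hsqrt : c ^ r ≤ Real.sqrt k := by
    apply Real.le_sqrt_of_sq_le
    rw [← pow_mul, ← hck]
    exact pow_le_pow_right₀ hc1.le (by omega)
  by_contra! hcon
  have hbound : ∀ i ≤ r + 1, ms i ≤ c ^ i * m := by
    intro i
    induction i with
    | zero => simp [h0]
    | succ i ih =>
      intro hi
      have hi' : i ≤ r := by omega
      have hmi := ih (by omega)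
      have hpow : c ^ i ≤ Real.sqrt k := (pow_le_pow_right₀ hc1.le hi').trans hsqrt
      by_contra! hlt
      rw [pow_succ'] at hlt
      have h1 : c * m < ms (i + 1) := by
        refine lt_of_le_of_lt ?_ hlt
        gcongr
        exact le_mul_of_one_le_right hc0.le (one_le_pow₀ hc1.le)
      have h2 : c * ms i < ms (i + 1) := by
        refine lt_of_le_of_lt ?_ hlt
        rw [mul_assoc]
        gcongr
      exact (hcon i hi' h1 h2).not_ge (hmi.trans (by gcongr))
  have hle := hbound (r + 1) le_rfl
  rw [hlast, ← hck] at hle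
  exact (le_of_mul_le_mul_right hle hm).not_gt (pow_lt_pow_right₀ hc1 (by omega))
end

section
/- Fix integers r ≥ 2 and ν ≥ 1, set b_0 = r!·((ν+1)r)^(r+1), and assume that every r-uniform, r-partite hypergraph H' with ν(H') ≤ ν satisfies τ(H') ≤ (r−1)·ν(H'). Call an r-uniform, r-partite hypergraph (a,b)-basic if it has no isolated vertices and is the union of a core-disjoint r-uniform sunflowers S_1, …, S_a, each with nonempty core and (ν+1)·r petals, together with an r-uniform, r-partite hypergraph R with ν(R) ≤ ν − a and exactly b edges which contains no sunflower with (ν+1)·r petals and nonempty core and whose vertex set is disjoint from the cores of S_1, …, S_a. Then for all 0 ≤ a ≤ ν and 0 ≤ b ≤ b_0, every (a,b)-basic hypergraph H is (r−1)ν-Ryser-stable relative to the collection consisting of M_{r,ν+1} together with all (a',b')-basic hypergraphs for pairs (a',b') with 0 ≤ a' ≤ ν, 0 ≤ b' ≤ b_0, and (a',b') strictly greater than (a,b) in lexicographic order. -/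
/-- `M` is a matching of `H`: a set of edges of `H` that pairwise share no vertex. -/
def IsMatching {r : ℕ} (H : PHyp r) (M : Finset (Fin r → ℕ)) : Prop :=
  M ⊆ H ∧ (M : Set (Fin r → ℕ)).Pairwise fun e f => ∀ i, e i ≠ f i

/-- The matching number of `H` is exactly `n`. -/
def MatchNumEq {r : ℕ} (H : PHyp r) (n : ℕ) : Prop :=
  (∀ M, IsMatching H M → M.card ≤ n) ∧ ∃ M, IsMatching H M ∧ M.card = n

/-- `H` is `c`-Ryser-stable relative to the collection `R` of hypergraphs: there is a
vertex cover `C` of `H` of size (at most) `c` such that every hypergraph `H'` containing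
`H` is either covered by `C` or contains a copy of a member of `R`. -/
def RyserStableRel {r : ℕ} (c : ℕ) (H : PHyp r) (R : Set (PHyp r)) : Prop :=
  ∃ C : Finset (Fin r × ℕ), IsCover H C ∧ C.card ≤ c ∧
    ∀ H' : PHyp r, H ⊆ H' → (IsCover H' C ∨ ∃ K ∈ R, ContainsCopy H' K)

/-- `M_{r,ν}`, the `r`-uniform matching with `ν` pairwise disjoint edges. -/
def matchingHyp (r ν : ℕ) : PHyp r :=
  (Finset.range ν).image fun j => fun _ : Fin r => j

/-- `S` is a sunflower with `t` petals inside the `r`-partite setting, with core given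
by the partial transversal `c` on the set of parts `I`: all `t` edges agree with `c` on
`I` and any two distinct edges differ in every part outside `I` (so two distinct edges
intersect exactly in the core `{(i, c i) : i ∈ I}`). -/
def IsPSunflower {r : ℕ} (t : ℕ) (S : PHyp r) (I : Finset (Fin r)) (c : Fin r → ℕ) :
    Prop :=
  S.card = t ∧ (∀ e ∈ S, ∀ i ∈ I, e i = c i) ∧
    (S : Set (Fin r → ℕ)).Pairwise fun e f => ∀ i, i ∉ I → e i ≠ f i

/-- `H` is `(a,b)`-basic: it is the union of `a` core-disjoint sunflowers with nonempty
cores and `(ν+1)·r` petals each, together with a hypergraph `R` with `ν(R) ≤ ν − a` and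
exactly `b` edges, containing no sunflower with `(ν+1)·r` petals and nonempty core, and
whose vertex set is disjoint from the cores of the sunflowers. -/
def IsBasic (r ν a b : ℕ) (H : PHyp r) : Prop :=
  ∃ (S : Fin a → PHyp r) (I : Fin a → Finset (Fin r)) (c : Fin a → Fin r → ℕ)
    (R : PHyp r),
      (∀ j, IsPSunflower ((ν + 1) * r) (S j) (I j) (c j)) ∧
      (∀ j, (I j).Nonempty) ∧
      -- the cores are pairwise disjoint:
      (∀ j j', j ≠ j' → ∀ i : Fin r, i ∈ I j → i ∈ I j' → c j i ≠ c j' i) ∧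
      (∀ M, IsMatching R M → M.card ≤ ν - a) ∧
      R.card = b ∧
      -- `R` contains no sunflower with `(ν+1)·r` petals and nonempty core:
      (¬ ∃ S' ⊆ R, ∃ (I' : Finset (Fin r)) (c' : Fin r → ℕ),
          I'.Nonempty ∧ IsPSunflower ((ν + 1) * r) S' I' c') ∧
      -- the vertex set of `R` is disjoint from the cores:
      (∀ e ∈ R, ∀ j, ∀ i ∈ I j, e i ≠ c j i) ∧
      H = Finset.univ.biUnion S ∪ R

/-- The vertices of the edge `e`. -/
def edgeVerts {r : ℕ} (e : Fin r → ℕ) : Finset (Fin r × ℕ) :=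
  Finset.univ.image fun i => (i, e i)

/-- The vertices of the core given by the partial transversal `c` on the parts `I`. -/
def coreVerts {r : ℕ} (I : Finset (Fin r)) (c : Fin r → ℕ) : Finset (Fin r × ℕ) :=
  I.image fun i => (i, c i)

theorem mem_edgeVerts {r : ℕ} {e : Fin r → ℕ} {i : Fin r} {v : ℕ} :
    (i, v) ∈ edgeVerts e ↔ e i = v := by
  simp [edgeVerts]

theorem mem_coreVerts {r : ℕ} {I : Finset (Fin r)} {c : Fin r → ℕ} {i : Fin r} {v : ℕ} :
    (i, v) ∈ coreVerts I c ↔ i ∈ I ∧ c i = v := by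
  simp only [coreVerts, Finset.mem_image, Prod.mk.injEq]
  constructor
  · rintro ⟨j, hj, rfl, h⟩
    exact ⟨hj, h⟩
  · rintro ⟨hi, h⟩
    exact ⟨i, hi, rfl, h⟩

theorem card_edgeVerts_le {r : ℕ} (e : Fin r → ℕ) : (edgeVerts e).card ≤ r :=
  Finset.card_image_le.trans (by simp)

theorem card_coreVerts_le {r : ℕ} (I : Finset (Fin r)) (c : Fin r → ℕ) :
    (coreVerts I c).card ≤ I.card :=
  Finset.card_image_le

theorem ContainsCopy.of_subset {r : ℕ} {H' K : PHyp r} (h : K ⊆ H') : ContainsCopy H' K :=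
  ⟨fun _ v => v, fun _ => Function.injective_id.injOn, fun _ he => h he⟩

theorem IsMatching.containsCopy {r n : ℕ} {H M : PHyp r} (hM : IsMatching H M)
    (hn : n ≤ M.card) : ContainsCopy H (matchingHyp r n) := by
  classical
  let m : Fin M.card ≃ M := M.equivFin.symm
  refine ⟨fun i v => if h : v < M.card then (m ⟨v, h⟩ : Fin r → ℕ) i else 0, ?_, ?_⟩
  · have key : ∀ i : Fin r, ∀ v, (∃ e ∈ matchingHyp r n, e i = v) → v < M.card := by
      rintro i v ⟨e, he, rfl⟩
      simp only [matchingHyp, Finset.mem_image, Finset.mem_range] at he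
      obtain ⟨j, hj, rfl⟩ := he
      exact lt_of_lt_of_le hj hn
    intro i v hv w hw hvw
    have hv' := key i v hv
    have hw' := key i w hw
    simp only [hv', hw', dif_pos] at hvw
    by_contra hne
    refine hM.2 (m ⟨v, hv'⟩).2 (m ⟨w, hw'⟩).2 (fun h => hne ?_) i hvw
    simpa using m.injective (Subtype.ext h)
  · intro e he
    simp only [matchingHyp, Finset.mem_image, Finset.mem_range] at he
    obtain ⟨j, hj, rfl⟩ := he
    have hj' : j < M.card := lt_of_lt_of_le hj hn
    simp only [hj', dif_pos]
    exact hM.1 (m ⟨j, hj'⟩).2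

theorem exists_matchNumEq {r : ℕ} (H : PHyp r) : ∃ n, MatchNumEq H n := by
  classical
  obtain ⟨M, hM, hmax⟩ := Finset.exists_max_image (H.powerset.filter (IsMatching H))
    Finset.card ⟨∅, by simp [IsMatching]⟩
  simp only [Finset.mem_filter, Finset.mem_powerset] at hM hmax
  exact ⟨M.card, fun M' hM' => hmax M' ⟨hM'.1, hM'⟩, M, hM.2, rfl⟩

/-- A sunflower has an edge avoiding any small vertex set disjoint from the core. -/
theorem IsPSunflower.exists_avoiding {r t : ℕ} {S : PHyp r} {I : Finset (Fin r)}
    {c : Fin r → ℕ} (hS : IsPSunflower t S I c) {U : Finset (Fin r × ℕ)} (hU : U.card < t)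
    (hUc : ∀ i ∈ I, (i, c i) ∉ U) : ∃ e ∈ S, ∀ i, (i, e i) ∉ U := by
  by_contra! hcon
  obtain ⟨e₀, he₀⟩ : S.Nonempty := Finset.card_pos.1 (by rw [hS.1]; omega)
  have : Nonempty (Fin r) := (hcon e₀ he₀).nonempty
  choose! g hg using hcon
  have hle : S.card ≤ U.card := by
    refine Finset.card_le_card_of_injOn (fun e => (g e, e (g e))) hg ?_
    intro e he f hf hef
    simp only [Prod.mk.injEq] at hef
    by_contra hne
    have hgI : g e ∉ I := by
      intro hi
      have := hg e he
      rw [hS.2.1 e he _ hi] at this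
      exact hUc _ hi this
    refine hS.2.2 he hf hne (g e) hgI ?_
    rw [hef.2, hef.1]
  have := hS.1
  omega

/-- Adding to a matching an edge that is disjoint from all its edges. -/
theorem IsMatching.insert {r : ℕ} {H M : PHyp r} {e : Fin r → ℕ} (hM : IsMatching H M)
    (he : e ∈ H) (hd : ∀ f ∈ M, ∀ i, e i ≠ f i) : IsMatching H (Insert.insert e M) := by
  refine ⟨Finset.insert_subset he hM.1, ?_⟩
  rw [Finset.coe_insert]
  exact hM.2.insert fun f hf _ => ⟨hd f hf, fun i => (hd f hf i).symm⟩

theorem card_biUnion_edgeVerts_le {r : ℕ} (M : PHyp r) :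
    (M.biUnion edgeVerts).card ≤ M.card * r :=
  Finset.card_biUnion_le_card_mul _ _ _ fun e _ => card_edgeVerts_le e

/-- A matching avoiding the cores of core-disjoint sunflowers with many petals can be
extended by one edge of each sunflower. -/
theorem IsMatching.extend_sunflowers {r a n t : ℕ} (hr : 0 < r) {H M : PHyp r}
    {S : Fin a → PHyp r} {I : Fin a → Finset (Fin r)} {c : Fin a → Fin r → ℕ}
    (hS : ∀ j, IsPSunflower t (S j) (I j) (c j)) (hSH : ∀ j, S j ⊆ H)
    (hdisj : ∀ j j', j ≠ j' → ∀ i : Fin r, i ∈ I j → i ∈ I j' → c j i ≠ c j' i)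
    (hM : IsMatching H M) (hMc : ∀ e ∈ M, ∀ j, ∀ i ∈ I j, e i ≠ c j i)
    (hn : M.card + a = n) (ht : n * r ≤ t) : ∃ M', IsMatching H M' ∧ M'.card = n := by
  classical
  suffices h : ∀ J : Finset (Fin a), ∃ M', IsMatching H M' ∧ M'.card = M.card + J.card ∧
      ∀ e ∈ M', ∀ j ∉ J, ∀ i ∈ I j, e i ≠ c j i by
    obtain ⟨M', h1, h2, -⟩ := h Finset.univ
    exact ⟨M', h1, by simpa [hn] using h2⟩
  intro J
  induction J using Finset.induction_on with
  | empty => exact ⟨M, hM, by simp, fun e he j _ => hMc e he j⟩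
  | insert k J hk ih =>
    obtain ⟨N, hN, hNcard, hNc⟩ := ih
    set U : Finset (Fin r × ℕ) := N.biUnion edgeVerts ∪
      (Insert.insert k J)ᶜ.biUnion fun j => coreVerts (I j) (c j) with hUdef
    have hcompl : ((Insert.insert k J)ᶜ).card + (J.card + 1) = a := by
      have h1 := Finset.card_compl_add_card (Insert.insert k J)
      rwa [Finset.card_insert_of_notMem hk, Fintype.card_fin] at h1
    have hUcard : U.card < t := by
      have h1 := card_biUnion_edgeVerts_le N
      have h2 : ((Insert.insert k J)ᶜ.biUnion fun j => coreVerts (I j) (c j)).card ≤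
          ((Insert.insert k J)ᶜ).card * r :=
        Finset.card_biUnion_le_card_mul _ _ _ fun j _ =>
          (card_coreVerts_le _ _).trans ((Finset.card_le_univ _).trans (by simp))
      have h3 : n * r = N.card * r + ((Insert.insert k J)ᶜ).card * r + r := by
        have h4 : n = N.card + ((Insert.insert k J)ᶜ).card + 1 := by omega
        rw [h4]; ring
      have h4 := Finset.card_union_le (N.biUnion edgeVerts)
        ((Insert.insert k J)ᶜ.biUnion fun j => coreVerts (I j) (c j))
      rw [← hUdef] at h4
      omega
    have hmem : ∀ i v, (i, v) ∈ U ↔ (∃ f ∈ N, f i = v) ∨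
        ∃ j, j ∉ Insert.insert k J ∧ i ∈ I j ∧ c j i = v := by
      intro i v
      simp only [hUdef, Finset.mem_union, Finset.mem_biUnion, mem_edgeVerts, mem_coreVerts,
        Finset.mem_compl]
    obtain ⟨e, heS, heU⟩ := (hS k).exists_avoiding hUcard (by
      intro i hi hmemU
      rcases (hmem _ _).1 hmemU with ⟨f, hf, hfi⟩ | ⟨j, hj, hij, hc⟩
      · exact hNc f hf k hk i hi hfi
      · exact hdisj j k (by rintro rfl; simp at hj) i hij hi hc)
    have heN : ∀ f ∈ N, ∀ i, e i ≠ f i := fun f hf i h =>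
      heU i ((hmem _ _).2 (Or.inl ⟨f, hf, h.symm⟩))
    refine ⟨Insert.insert e N, hN.insert (hSH k heS) heN, ?_, ?_⟩
    · have : e ∉ N := fun h => heN e h ⟨0, hr⟩ rfl
      rw [Finset.card_insert_of_notMem this, Finset.card_insert_of_notMem hk, hNcard]
      ring
    · intro f hf j hj i hi
      rcases Finset.mem_insert.1 hf with rfl | hf
      · exact fun h => heU i ((hmem _ _).2 (Or.inr ⟨j, hj, hi, h.symm⟩))
      · exact hNc f hf j (fun h => hj (Finset.mem_insert_of_mem h)) i hi

/-- The sunflower lemma for edges agreeing on the parts `I`. -/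
theorem exists_sunflower_of_agree {r t : ℕ} (k : ℕ) :
    ∀ (F : PHyp r) (I : Finset (Fin r)) (c : Fin r → ℕ), (Iᶜ).card = k →
      (∀ e ∈ F, ∀ i ∈ I, e i = c i) → k.factorial * t ^ k < F.card →
      ∃ S ⊆ F, ∃ (I' : Finset (Fin r)) (c' : Fin r → ℕ), IsPSunflower (t + 1) S I' c' := by
  classical
  induction k with
  | zero =>
    intro F I c hI hF hcard
    exfalso
    obtain ⟨e, he, f, hf, hne⟩ := Finset.one_lt_card.1 (by simpa using hcard)
    have hIuniv : ∀ i, i ∈ I := fun i => by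
      have := Finset.card_eq_zero.1 hI
      simpa using Finset.eq_empty_iff_forall_notMem.1 this i
    exact hne (funext fun i => (hF e he i (hIuniv i)).trans (hF f hf i (hIuniv i)).symm)
  | succ k ih =>
    intro F I c hI hF hcard
    let P : PHyp r → Prop := fun M =>
      (M : Set (Fin r → ℕ)).Pairwise fun e f => ∀ i, i ∉ I → e i ≠ f i
    obtain ⟨M, hM, hmax⟩ := Finset.exists_max_image (F.powerset.filter P)
      Finset.card ⟨∅, by simp [P]⟩
    simp only [Finset.mem_filter, Finset.mem_powerset] at hM hmax
    by_cases hMt : t + 1 ≤ M.card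
    · obtain ⟨S, hSM, hScard⟩ := Finset.exists_subset_card_eq hMt
      exact ⟨S, hSM.trans hM.1, I, c, hScard,
        fun e he => hF e (hM.1 (hSM he)), hM.2.mono (by exact_mod_cast hSM)⟩
    have hmeet : ∀ f ∈ F, ∃ e ∈ M, ∃ i ∉ I, e i = f i := by
      intro f hf
      by_contra! hcon
      by_cases hfM : f ∈ M
      · obtain ⟨i, hi⟩ : (Iᶜ).Nonempty := Finset.card_pos.1 (by omega)
        exact hcon f hfM i (by simpa using hi) rfl
      · have h1 := hmax (Insert.insert f M) ⟨Finset.insert_subset hf hM.1, by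
          simp only [P, Finset.coe_insert]
          exact hM.2.insert fun g hg _ =>
            ⟨fun i hi => (hcon g hg i hi).symm, fun i hi => hcon g hg i hi⟩⟩
        rw [Finset.card_insert_of_notMem hfM] at h1
        omega
    have hsub : F ⊆ (M ×ˢ Iᶜ).biUnion fun p => F.filter fun f => f p.2 = p.1 p.2 := by
      intro f hf
      obtain ⟨e, he, i, hi, hei⟩ := hmeet f hf
      simp only [Finset.mem_biUnion, Finset.mem_product, Finset.mem_filter, Finset.mem_compl]
      exact ⟨(e, i), ⟨he, hi⟩, hf, hei.symm⟩
    obtain ⟨p, hp, hpcard⟩ : ∃ p ∈ M ×ˢ Iᶜ,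
        k.factorial * t ^ k < (F.filter fun f => f p.2 = p.1 p.2).card := by
      by_contra! hcon
      have h1 := (Finset.card_le_card hsub).trans
        (Finset.card_biUnion_le_card_mul _ _ _ hcon)
      rw [Finset.card_product, hI] at h1
      have h2 : M.card * (k + 1) * (k.factorial * t ^ k) ≤
          t * (k + 1) * (k.factorial * t ^ k) := by gcongr; omega
      have h3 : t * (k + 1) * (k.factorial * t ^ k) = (k + 1).factorial * t ^ (k + 1) := by
        rw [Nat.factorial_succ]; ring
      omega
    have hpI : p.2 ∉ I := by simpa using (Finset.mem_product.1 hp).2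
    obtain ⟨S, hSF, I', c', hS⟩ := ih (F.filter fun f => f p.2 = p.1 p.2)
      (Insert.insert p.2 I) (Function.update c p.2 (p.1 p.2)) (by
        have h1 := Finset.card_compl_add_card (Insert.insert p.2 I)
        have h2 := Finset.card_compl_add_card I
        rw [Finset.card_insert_of_notMem hpI] at h1
        omega) (by
        intro e he i hi
        rw [Finset.mem_filter] at he
        by_cases hip : i = p.2
        · subst hip; simpa using he.2
        · rw [Function.update_of_ne hip]
          exact hF e he.1 i ((Finset.mem_insert.1 hi).resolve_left hip)) hpcard
    exact ⟨S, hSF.trans (Finset.filter_subset _ _), I', c', hS⟩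

/-- A hypergraph with neither a matching nor a nonempty-core sunflower of size `t + 1` has
at most `r! * t ^ r` edges. -/
theorem card_le_of_no_sunflower {r t : ℕ} {R : PHyp r}
    (hmatch : ∀ M, IsMatching R M → M.card ≤ t)
    (hsun : ¬ ∃ S ⊆ R, ∃ (I : Finset (Fin r)) (c : Fin r → ℕ),
      I.Nonempty ∧ IsPSunflower (t + 1) S I c) :
    R.card ≤ r.factorial * t ^ r := by
  by_contra! hcard
  obtain ⟨S, hSR, I, c, hS⟩ := exists_sunflower_of_agree (t := t) r R ∅ 0 (by simp)
    (by simp) hcard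
  rcases I.eq_empty_or_nonempty with rfl | hI
  · have := hmatch S ⟨hSR, fun e he f hf hne i => hS.2.2 he hf hne i (by simp)⟩
    rw [hS.1] at this
    omega
  · exact hsun ⟨S, hSR, I, c, hI, hS⟩

/-- The core of a sunflower with at least two petals misses some part. -/
theorem IsPSunflower.card_core_lt {r t : ℕ} {S : PHyp r} {I : Finset (Fin r)}
    {c : Fin r → ℕ} (hS : IsPSunflower t S I c) (ht : 1 < t) : I.card < r := by
  by_contra! hI
  have hIuniv : I = Finset.univ :=
    Finset.eq_univ_of_card I (le_antisymm (Finset.card_le_univ I) (by simpa using hI))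
  obtain ⟨e, he, f, hf, hne⟩ := Finset.one_lt_card.1 (hS.1.symm ▸ ht)
  exact hne (funext fun i => (hS.2.1 e he i (by simp [hIuniv])).trans
    (hS.2.1 f hf i (by simp [hIuniv])).symm)

/-- Removing all edges meeting the core of a large sunflower lowers the matching number. -/
theorem IsPSunflower.card_matching_lt {r t n : ℕ} (hr : 0 < r) {R S : PHyp r}
    {I : Finset (Fin r)} {c : Fin r → ℕ} (hS : IsPSunflower t S I c) (hSR : S ⊆ R)
    (ht : n * r < t) (hR : ∀ M, IsMatching R M → M.card ≤ n) {M : PHyp r}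
    (hM : IsMatching R M) (hMc : ∀ f ∈ M, ∀ i ∈ I, f i ≠ c i) : M.card < n := by
  have hmem : ∀ i v, (i, v) ∈ M.biUnion edgeVerts ↔ ∃ f ∈ M, f i = v := by
    simp [mem_edgeVerts]
  have hU : (M.biUnion edgeVerts).card < t :=
    (card_biUnion_edgeVerts_le M).trans_lt
      ((Nat.mul_le_mul_right r (hR M hM)).trans_lt ht)
  obtain ⟨e, heS, heU⟩ := hS.exists_avoiding hU (by
    intro i hi h
    obtain ⟨f, hf, hfi⟩ := (hmem _ _).1 h
    exact hMc f hf i hi hfi)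
  have hd : ∀ f ∈ M, ∀ i, e i ≠ f i := fun f hf i h =>
    heU i ((hmem _ _).2 ⟨f, hf, h.symm⟩)
  have h1 := hR _ (hM.insert (hSR heS) hd)
  rwa [Finset.card_insert_of_notMem fun h => hd e h ⟨0, hr⟩ rfl] at h1

theorem stmt14 (r ν : ℕ) (hr : 2 ≤ r) (hν : 1 ≤ ν)
    (hRyser : ∀ (H' : PHyp r) (n : ℕ), MatchNumEq H' n → n ≤ ν →
        ∃ C, IsCover H' C ∧ C.card ≤ (r - 1) * n)
    (a b : ℕ) (ha : a ≤ ν) (hb : b ≤ Nat.factorial r * ((ν + 1) * r) ^ (r + 1))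
    (H : PHyp r) (hH : IsBasic r ν a b H) :
    RyserStableRel ((r - 1) * ν) H
      ({matchingHyp r (ν + 1)} ∪
        {K | ∃ a' b', a' ≤ ν ∧ b' ≤ Nat.factorial r * ((ν + 1) * r) ^ (r + 1) ∧
          (a < a' ∨ (a = a' ∧ b < b')) ∧ IsBasic r ν a' b' K}) := by
  classical
  obtain ⟨S, I, c, R, hS, hI, hdisj, hRm, hRb, hRs, hRc, rfl⟩ := hH
  have hr0 : 0 < r := by omega
  obtain ⟨n, hn⟩ := exists_matchNumEq R
  have hna : n ≤ ν - a := by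
    obtain ⟨M, hM, rfl⟩ := hn.2
    exact hRm M hM
  obtain ⟨D, hD, hDcard⟩ := hRyser R n hn (by omega)
  have hCmem : ∀ p, p ∈ (Finset.univ.biUnion fun j => coreVerts (I j) (c j)) ∪ D ↔
      (∃ j, p ∈ coreVerts (I j) (c j)) ∨ p ∈ D := by simp
  refine ⟨(Finset.univ.biUnion fun j => coreVerts (I j) (c j)) ∪ D, ?_, ?_, ?_⟩
  · intro e he
    rcases Finset.mem_union.1 he with he | he
    · obtain ⟨j, -, hj⟩ := Finset.mem_biUnion.1 he
      obtain ⟨i, hi⟩ := hI j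
      exact ⟨i, (hCmem _).2 (Or.inl ⟨j, mem_coreVerts.2 ⟨hi, ((hS j).2.1 e hj i hi).symm⟩⟩)⟩
    · obtain ⟨i, hi⟩ := hD e he
      exact ⟨i, (hCmem _).2 (Or.inr hi)⟩
  · have h1 : (Finset.univ.biUnion fun j => coreVerts (I j) (c j)).card ≤
        (Finset.univ : Finset (Fin a)).card * (r - 1) :=
      Finset.card_biUnion_le_card_mul _ _ _ fun j _ => by
        have h2 := (hS j).card_core_lt (by nlinarith)
        have h3 := card_coreVerts_le (I j) (c j)
        omega
    rw [Finset.card_univ, Fintype.card_fin] at h1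
    have h2 : (r - 1) * n ≤ (r - 1) * (ν - a) := Nat.mul_le_mul_left _ hna
    have h3 : (r - 1) * ν = a * (r - 1) + (r - 1) * (ν - a) := by
      rw [mul_comm a, ← mul_add, Nat.add_sub_cancel' ha]
    exact (Finset.card_union_le _ _).trans (by omega)
  intro H' hHH'
  refine or_iff_not_imp_left.2 fun hcov => ?_
  have hSH' : ∀ j, S j ⊆ H' := fun j e he =>
    hHH' (Finset.mem_union_left _ (Finset.mem_biUnion.2 ⟨j, Finset.mem_univ j, he⟩))
  obtain ⟨e, heH', heC⟩ : ∃ e ∈ H', ∀ i,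
      (i, e i) ∉ (Finset.univ.biUnion fun j => coreVerts (I j) (c j)) ∪ D := by
    simpa only [IsCover, not_forall, not_exists, exists_prop] using hcov
  have hec : ∀ j, ∀ i ∈ I j, e i ≠ c j i := fun j i hi h =>
    heC i ((hCmem _).2 (Or.inl ⟨j, mem_coreVerts.2 ⟨hi, h.symm⟩⟩))
  have heR : e ∉ R := fun h => by
    obtain ⟨i, hi⟩ := hD e h
    exact heC i ((hCmem _).2 (Or.inr hi))
  have hR'H' : insert e R ⊆ H' :=
    Finset.insert_subset heH' (Finset.subset_union_right.trans hHH')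
  have hR'c : ∀ f ∈ insert e R, ∀ j, ∀ i ∈ I j, f i ≠ c j i := by
    intro f hf
    rcases Finset.mem_insert.1 hf with rfl | hf
    · exact hec
    · exact hRc f hf
  by_cases hbig : ∃ M, IsMatching (insert e R) M ∧ ν - a < M.card
  · obtain ⟨M, hM, hMcard⟩ := hbig
    obtain ⟨N, hNM, hN⟩ := Finset.exists_subset_card_eq (Nat.succ_le_of_lt hMcard)
    have hNmatch : IsMatching H' N :=
      ⟨(hNM.trans hM.1).trans hR'H', hM.2.mono (by exact_mod_cast hNM)⟩
    obtain ⟨M', hM', hM'card⟩ := hNmatch.extend_sunflowers hr0 hS hSH' hdisj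
      (fun f hf => hR'c f (hM.1 (hNM hf))) (n := ν + 1) (by omega) le_rfl
    exact ⟨_, Or.inl rfl, hM'.containsCopy hM'card.ge⟩
  push Not at hbig
  by_cases hsun : ∃ S' ⊆ insert e R, ∃ (I' : Finset (Fin r)) (c' : Fin r → ℕ),
      I'.Nonempty ∧ IsPSunflower ((ν + 1) * r) S' I' c'
  · obtain ⟨S', hS'R, I', c', hI', hS'⟩ := hsun
    have heS' : e ∈ S' := by
      by_contra h
      exact hRs ⟨S', (Finset.subset_insert_iff_of_notMem h).1 hS'R, I', c', hI', hS'⟩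
    have haν : a < ν := by
      have h1 := hbig {e} ⟨by simp, by simp⟩
      rw [Finset.card_singleton] at h1
      omega
    have hcore : ∀ j, ∀ i ∈ I', i ∈ I j → c' i ≠ c j i := fun j i hi hij => by
      rw [← hS'.2.1 e heS' i hi]
      exact hec j i hij
    set R'' := R.filter fun f => ∀ i ∈ I', f i ≠ c' i with hR''
    have hR''R : R'' ⊆ R := Finset.filter_subset _ _
    have hR''card : R''.card ≤ b := hRb ▸ Finset.card_le_card hR''R
    refine ⟨Finset.univ.biUnion (Fin.cons S' S : Fin (a + 1) → PHyp r) ∪ R'',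
      Or.inr ⟨a + 1, R''.card, haν, hR''card.trans hb, Or.inl (Nat.lt_succ_self a),
        Fin.cons S' S, Fin.cons I' I, Fin.cons c' c, R'', ?_, ?_, ?_, ?_, rfl, ?_, ?_, rfl⟩,
      .of_subset ?_⟩
    · exact Fin.cases hS' hS
    · exact Fin.cases hI' hI
    · refine Fin.cases (Fin.cases (fun h => (h rfl).elim) fun j _ => hcore j) fun j =>
        Fin.cases (fun _ i hi hi' => (hcore j i hi' hi).symm) fun j' hne =>
          hdisj j j' fun h => hne (h ▸ rfl)
    · intro M hM
      have h1 := hS'.card_matching_lt hr0 hS'R (n := ν - a)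
        (Nat.mul_lt_mul_of_pos_right (by omega) hr0) hbig (M := M)
        ⟨(hM.1.trans hR''R).trans (Finset.subset_insert _ _), hM.2⟩
        fun f hf => (Finset.mem_filter.1 (hM.1 hf)).2
      omega
    · rintro ⟨T, hT, h⟩
      exact hRs ⟨T, hT.trans hR''R, h⟩
    · intro f hf
      exact Fin.cases (Finset.mem_filter.1 hf).2 (hRc f (hR''R hf))
    · refine Finset.union_subset (Finset.biUnion_subset.2 fun j _ => ?_)
        ((hR''R.trans (Finset.subset_insert _ _)).trans hR'H')
      exact Fin.cases (motive := fun j => (Fin.cons S' S : Fin (a + 1) → PHyp r) j ⊆ H')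
        (hS'R.trans hR'H') hSH' j
  · have hcard : (insert e R).card = b + 1 := by rw [Finset.card_insert_of_notMem heR, hRb]
    obtain ⟨t, ht⟩ : ∃ t, (ν + 1) * r = t + 1 :=
      Nat.exists_eq_succ_of_ne_zero (by positivity)
    have hbound : (insert e R).card ≤ r.factorial * ((ν + 1) * r) ^ (r + 1) := by
      refine (card_le_of_no_sunflower (t := t) (fun M hM => (hbig M hM).trans ?_)
        (ht ▸ hsun)).trans (Nat.mul_le_mul_left _ ?_)
      · have : ν + 1 ≤ (ν + 1) * r := Nat.le_mul_of_pos_right _ hr0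
        omega
      · rw [ht]
        exact (Nat.pow_le_pow_left (Nat.le_succ t) r).trans
          (Nat.pow_le_pow_right (Nat.succ_pos t) (Nat.le_succ r))
    exact ⟨Finset.univ.biUnion S ∪ insert e R,
      Or.inr ⟨a, b + 1, ha, hcard ▸ hbound, Or.inr ⟨rfl, Nat.lt_succ_self b⟩,
        S, I, c, insert e R, hS, hI, hdisj, hbig, hcard, hsun, hR'c, rfl⟩,
      .of_subset (Finset.union_subset (Finset.biUnion_subset.2 fun j _ => hSH' j) hR'H')⟩
end
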